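/- arXiv:2405.03249 — 3 statements merged into one kernel-verified Lean document; each statement's English description precedes it below -/
import Mathlib

section
/- Let g = (g1,g2) be a vector field on ℝ² with smooth (C³) components compactly supported in the open unit disk, and let f = dg, i.e. f11 = ∂g1/∂x1, f12 = (1/2)·(∂g1/∂x2 + ∂g2/∂x1), f22 = ∂g2/∂x2. Then for every x ∈ ℝ², g2(x) = -(1/(2·u2))·Lf(x). -/
open MeasureTheory

noncomputable section

/-- Rotation of a vector by 90 degrees: `w⊥ = (-w2, w1)`. -/
def perp (w : ℝ × ℝ) : ℝ × ℝ := (-w.2, w.1)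

/-- Divergent beam transform `X_w h (x) = ∫_0^∞ h(x + t w) dt`. -/
def Xray (w : ℝ × ℝ) (h : ℝ × ℝ → ℝ) (x : ℝ × ℝ) : ℝ :=
  ∫ t in Set.Ioi (0:ℝ), h (x + t • w)

/-- First moment divergent beam transform `X¹_w h (x) = ∫_0^∞ t·h(x + t w) dt`. -/
def Xray1 (w : ℝ × ℝ) (h : ℝ × ℝ → ℝ) (x : ℝ × ℝ) : ℝ :=
  ∫ t in Set.Ioi (0:ℝ), t * h (x + t • w)

/-- Directional derivative `D_w h = w1 ∂h/∂x1 + w2 ∂h/∂x2`. -/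
def Dw (w : ℝ × ℝ) (h : ℝ × ℝ → ℝ) (x : ℝ × ℝ) : ℝ :=
  fderiv ℝ h x w

/-- Partial derivative in the first coordinate. -/
def pdx (h : ℝ × ℝ → ℝ) : ℝ × ℝ → ℝ := Dw (1, 0) h

/-- Partial derivative in the second coordinate. -/
def pdy (h : ℝ × ℝ → ℝ) : ℝ × ℝ → ℝ := Dw (0, 1) h

/-- The open unit disk in ℝ². -/
def unitDisk : Set (ℝ × ℝ) := {x | x.1 ^ 2 + x.2 ^ 2 < 1}

/-- `⟨f, w²⟩ = f11 w1² + 2 f12 w1 w2 + f22 w2²`. -/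
def proj2 (f11 f12 f22 : ℝ × ℝ → ℝ) (w : ℝ × ℝ) (x : ℝ × ℝ) : ℝ :=
  f11 x * w.1 ^ 2 + 2 * f12 x * w.1 * w.2 + f22 x * w.2 ^ 2

/-- `⟨f, w ⊙ w⊥⟩ = -f11 w1 w2 + f12 (w1² - w2²) + f22 w1 w2`. -/
def projMix (f11 f12 f22 : ℝ × ℝ → ℝ) (w : ℝ × ℝ) (x : ℝ × ℝ) : ℝ :=
  -(f11 x) * w.1 * w.2 + f12 x * (w.1 ^ 2 - w.2 ^ 2) + f22 x * w.1 * w.2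

/-- V-line transform of a scalar function. -/
def Vlt (u v : ℝ × ℝ) (h : ℝ × ℝ → ℝ) (x : ℝ × ℝ) : ℝ := Xray u h x + Xray v h x

/-- Longitudinal V-line transform. -/
def Lf (u v : ℝ × ℝ) (f11 f12 f22 : ℝ × ℝ → ℝ) (x : ℝ × ℝ) : ℝ :=
  Xray u (proj2 f11 f12 f22 u) x + Xray v (proj2 f11 f12 f22 v) x

/-- Transverse V-line transform. -/
def Tf (u v : ℝ × ℝ) (f11 f12 f22 : ℝ × ℝ → ℝ) (x : ℝ × ℝ) : ℝ :=
  Xray u (proj2 f11 f12 f22 (perp u)) x + Xray v (proj2 f11 f12 f22 (perp v)) x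

/-- Mixed V-line transform. -/
def Mf (u v : ℝ × ℝ) (f11 f12 f22 : ℝ × ℝ → ℝ) (x : ℝ × ℝ) : ℝ :=
  Xray u (projMix f11 f12 f22 u) x + Xray v (projMix f11 f12 f22 v) x

/-- First moment longitudinal V-line transform. -/
def L1f (u v : ℝ × ℝ) (f11 f12 f22 : ℝ × ℝ → ℝ) (x : ℝ × ℝ) : ℝ :=
  Xray1 u (proj2 f11 f12 f22 u) x + Xray1 v (proj2 f11 f12 f22 v) x

lemma hasCompactSupport_of_tsupport_subset_unitDisk {h : ℝ × ℝ → ℝ}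
    (hh : tsupport h ⊆ unitDisk) : HasCompactSupport h := by
  refine (isCompact_Icc (a := ((-1, -1) : ℝ × ℝ)) (b := (1, 1))).of_isClosed_subset
    (isClosed_tsupport h) fun y hy => ?_
  have hy' : y.1 ^ 2 + y.2 ^ 2 < 1 := hh hy
  refine ⟨⟨?_, ?_⟩, ⟨?_, ?_⟩⟩ <;> dsimp only <;> nlinarith [sq_nonneg y.1, sq_nonneg y.2]

/-- Integrating a directional derivative along its own ray recovers the function, up to sign. -/
lemma Xray_Dw {w : ℝ × ℝ} (hw : w ≠ 0) {h : ℝ × ℝ → ℝ} (hd : ContDiff ℝ 1 h)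
    (hs : HasCompactSupport h) (x : ℝ × ℝ) : Xray w (Dw w h) x = -h x := by
  have hray : ContDiff ℝ 1 fun t : ℝ => h (x + t • w) := by fun_prop
  have hsupp : HasCompactSupport fun t : ℝ => h (x + t • w) :=
    hs.comp_isClosedEmbedding
      ((Homeomorph.addLeft x).isClosedEmbedding.comp (isClosedEmbedding_smul_left hw))
  have hderiv (t : ℝ) : deriv (fun t : ℝ => h (x + t • w)) t = Dw w h (x + t • w) := by
    have hline : HasDerivAt (fun t : ℝ => x + t • w) w t := by
      simpa using ((hasDerivAt_id t).smul_const w).const_add x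
    exact (((hd.differentiable one_ne_zero) _).hasFDerivAt.comp_hasDerivAt t hline).deriv
  simpa [Xray, hderiv] using hsupp.integral_Ioi_deriv_eq hray 0

/-- The longitudinal part of a symmetrized derivative `dg` is the directional derivative of the
component of `g` along the direction. -/
lemma proj2_symm_deriv {g1 g2 : ℝ × ℝ → ℝ} (hg1 : Differentiable ℝ g1)
    (hg2 : Differentiable ℝ g2) (w : ℝ × ℝ) :
    proj2 (pdx g1) (fun x => (1 / 2) * (pdy g1 x + pdx g2 x)) (pdy g2) w =
      Dw w fun y => w.1 * g1 y + w.2 * g2 y := by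
  funext y
  have hexpand (L : ℝ × ℝ →L[ℝ] ℝ) : L w = w.1 * L (1, 0) + w.2 * L (0, 1) := by
    conv_lhs => rw [show w = w.1 • ((1, 0) : ℝ × ℝ) + w.2 • ((0, 1) : ℝ × ℝ) by ext <;> simp]
    simp only [map_add, map_smul, smul_eq_mul]
  have hsum : HasFDerivAt (fun y => w.1 * g1 y + w.2 * g2 y)
      (w.1 • fderiv ℝ g1 y + w.2 • fderiv ℝ g2 y) y :=
    ((hg1 y).hasFDerivAt.const_mul w.1).add ((hg2 y).hasFDerivAt.const_mul w.2)
  simp only [proj2, pdx, pdy, Dw, hsum.fderiv, add_apply,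
    smul_apply, smul_eq_mul]
  rw [hexpand (fderiv ℝ g1 y), hexpand (fderiv ℝ g2 y)]
  ring

/-- The longitudinal beam transform of `dg` is minus the component of `g` along the beam. -/
lemma Xray_proj2_symm_deriv {g1 g2 : ℝ × ℝ → ℝ} (hg1 : ContDiff ℝ 1 g1) (hg2 : ContDiff ℝ 1 g2)
    (hs1 : HasCompactSupport g1) (hs2 : HasCompactSupport g2) {w : ℝ × ℝ} (hw : w ≠ 0)
    (x : ℝ × ℝ) :
    Xray w (proj2 (pdx g1) (fun x => (1 / 2) * (pdy g1 x + pdx g2 x)) (pdy g2) w) x =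
      -(w.1 * g1 x + w.2 * g2 x) := by
  rw [proj2_symm_deriv (hg1.differentiable one_ne_zero) (hg2.differentiable one_ne_zero)]
  exact Xray_Dw hw ((contDiff_const.mul hg1).add (contDiff_const.mul hg2))
    (hs1.mul_left.add hs2.mul_left) x

theorem stmt_4 (u1 u2 : ℝ) (hu1 : 0 < u1) (hu2 : 0 < u2) (huv : u1 ^ 2 + u2 ^ 2 = 1)
    (g1 g2 : ℝ × ℝ → ℝ) (hg1 : ContDiff ℝ 3 g1) (hg2 : ContDiff ℝ 3 g2)
    (hg1supp : tsupport g1 ⊆ unitDisk) (hg2supp : tsupport g2 ⊆ unitDisk)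
    (f11 f12 f22 : ℝ × ℝ → ℝ)
    (hf11 : f11 = pdx g1)
    (hf12 : f12 = fun x => (1 / 2) * (pdy g1 x + pdx g2 x))
    (hf22 : f22 = pdy g2) :
    ∀ x : ℝ × ℝ, g2 x = -(1 / (2 * u2)) * Lf (u1, u2) (-u1, u2) f11 f12 f22 x := by
  intro x
  subst hf11 hf12 hf22
  have hc1 := hasCompactSupport_of_tsupport_subset_unitDisk hg1supp
  have hc2 := hasCompactSupport_of_tsupport_subset_unitDisk hg2supp
  have hbeam {w : ℝ × ℝ} (hw : w ≠ 0) :=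
    Xray_proj2_symm_deriv (hg1.of_le (by norm_num)) (hg2.of_le (by norm_num)) hc1 hc2 hw x
  rw [Lf, hbeam (by simp [hu2.ne']), hbeam (by simp [hu2.ne'])]
  field_simp
  ring
end
end

section
/- Let g = (g1,g2) be a vector field on ℝ² with smooth (C³) components compactly supported in the open unit disk, let f = dg, i.e. f11 = ∂g1/∂x1, f12 = (1/2)·(∂g1/∂x2 + ∂g2/∂x1), f22 = ∂g2/∂x2, and set h(x) = 2·Mf(x) + V(∂g2/∂x1)(x). Then g1 satisfies, at every x ∈ ℝ², the second-order partial differential equation 2·u1²·∂²g1/∂x1²(x) + (u1² - u2²)·∂²g1/∂x2²(x) = -(1/(2·u2))·D_u D_v h(x). -/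
open MeasureTheory

noncomputable section

section RayIntegrals

variable {F : Type*} [NormedAddCommGroup F]

/-- Rays issued from a unit ball uniformly leave the support of a compactly supported function. -/
lemma exists_ray_eq_zero {φ : ℝ × ℝ → F} (hφ : HasCompactSupport φ) {w : ℝ × ℝ} (hw : w ≠ 0)
    (x₀ : ℝ × ℝ) :
    ∃ R : ℝ, ∀ x ∈ Metric.ball x₀ 1, ∀ t : ℝ, R < |t| → φ (x + t • w) = 0 := by
  obtain ⟨K, hK⟩ := hφ.isCompact.isBounded.exists_norm_le
  have hw' : 0 < ‖w‖ := norm_pos_iff.2 hw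
  refine ⟨(K + ‖x₀‖ + 1) / ‖w‖, fun x hx t ht => ?_⟩
  by_contra hne
  have h1 := hK _ (subset_tsupport φ hne)
  rw [div_lt_iff₀ hw'] at ht
  have h2 : ‖x - x₀‖ < 1 := by simpa [dist_eq_norm] using hx
  have h3 : ‖t • w‖ ≤ ‖x + t • w‖ + ‖x‖ := by
    simpa using norm_sub_le (x + t • w) x
  have h4 : ‖x‖ ≤ ‖x - x₀‖ + ‖x₀‖ := by simpa using norm_add_le (x - x₀) x₀
  rw [norm_smul, Real.norm_eq_abs] at h3
  linarith

lemma HasCompactSupport.comp_ray {φ : ℝ × ℝ → F} (hφ : HasCompactSupport φ) {w : ℝ × ℝ}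
    (hw : w ≠ 0) (x : ℝ × ℝ) : HasCompactSupport fun t : ℝ => φ (x + t • w) := by
  obtain ⟨R, hR⟩ := exists_ray_eq_zero hφ hw x
  refine HasCompactSupport.intro (isCompact_Icc (a := -R) (b := R)) fun t ht => ?_
  refine hR x (Metric.mem_ball_self one_pos) t ?_
  rw [Set.mem_Icc, ← abs_le] at ht
  exact not_le.1 ht

lemma integrable_comp_ray {φ : ℝ × ℝ → F} (hc : Continuous φ) (hφ : HasCompactSupport φ)
    {w : ℝ × ℝ} (hw : w ≠ 0) (x : ℝ × ℝ) : Integrable fun t : ℝ => φ (x + t • w) :=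
  Continuous.integrable_of_hasCompactSupport (by fun_prop) (hφ.comp_ray hw x)

end RayIntegrals

lemma Xray_add {φ ψ : ℝ × ℝ → ℝ} (hφ : Continuous φ) (hφs : HasCompactSupport φ)
    (hψ : Continuous ψ) (hψs : HasCompactSupport ψ) {w : ℝ × ℝ} (hw : w ≠ 0) (x : ℝ × ℝ) :
    Xray w (fun y => φ y + ψ y) x = Xray w φ x + Xray w ψ x :=
  integral_add (integrable_comp_ray hφ hφs hw x).integrableOn
    (integrable_comp_ray hψ hψs hw x).integrableOn

lemma Xray_const_mul (c : ℝ) (φ : ℝ × ℝ → ℝ) (w x : ℝ × ℝ) :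
    Xray w (fun y => c * φ y) x = c * Xray w φ x :=
  integral_const_mul c _

/-- The divergent beam transform inverts the directional derivative along the beam. -/
lemma Xray_Dw_self {φ : ℝ × ℝ → ℝ} (hφ : ContDiff ℝ 1 φ) (hφs : HasCompactSupport φ)
    {w : ℝ × ℝ} (hw : w ≠ 0) (x : ℝ × ℝ) : Xray w (Dw w φ) x = -φ x := by
  have hd : ∀ t : ℝ, HasDerivAt (fun t : ℝ => φ (x + t • w)) (Dw w φ (x + t • w)) t := by
    intro t
    have h1 : HasDerivAt (fun t : ℝ => x + t • w) w t := by
      simpa using ((hasDerivAt_id t).smul_const w).const_add x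
    exact ((hφ.differentiable one_ne_zero _).hasFDerivAt).comp_hasDerivAt t h1
  have hc : ContDiff ℝ 1 fun t : ℝ => φ (x + t • w) := by fun_prop
  have := HasCompactSupport.integral_Ioi_deriv_eq hc (hφs.comp_ray hw x) 0
  simpa [Xray, funext fun t => (hd t).deriv] using this

/-- Differentiation of the divergent beam transform under the integral sign. -/
lemma hasFDerivAt_Xray {φ : ℝ × ℝ → ℝ} (hφ : ContDiff ℝ 1 φ) (hφs : HasCompactSupport φ)
    {w : ℝ × ℝ} (hw : w ≠ 0) (x : ℝ × ℝ) :
    HasFDerivAt (Xray w φ) (∫ t in Set.Ioi (0 : ℝ), fderiv ℝ φ (x + t • w)) x := by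
  have hφc : Continuous φ := hφ.continuous
  have hdc : Continuous (fderiv ℝ φ) := hφ.continuous_fderiv one_ne_zero
  have hds : HasCompactSupport (fderiv ℝ φ) := hφs.fderiv ℝ
  obtain ⟨C, hC⟩ := hds.exists_bound_of_continuous hdc
  obtain ⟨R, hR⟩ := exists_ray_eq_zero hds hw x
  refine hasFDerivAt_integral_of_dominated_of_fderiv_le
    (F := fun y t => φ (y + t • w)) (F' := fun y t => fderiv ℝ φ (y + t • w))
    (bound := (Set.Icc (-R) R).indicator fun _ => C) (Metric.ball_mem_nhds x one_pos)
    (.of_forall fun y => Continuous.aestronglyMeasurable (by fun_prop))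
    (integrable_comp_ray hφc hφs hw x).integrableOn
    (Continuous.aestronglyMeasurable (by fun_prop)) (.of_forall fun t y hy => ?_) ?_
    (.of_forall fun t y _ => ?_)
  · by_cases ht : t ∈ Set.Icc (-R) R
    · simpa [Set.indicator_of_mem ht] using hC _
    · rw [Set.indicator_of_notMem ht]
      rw [Set.mem_Icc, ← abs_le, not_le] at ht
      simp [hR y hy t ht]
  · exact ((integrable_indicator_iff measurableSet_Icc).2
      (integrableOn_const (by simp))).integrableOn
  · exact ((hφ.differentiable one_ne_zero _).hasFDerivAt).comp y ((hasFDerivAt_id y).add_const (t • w))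

lemma Dw_Xray {φ : ℝ × ℝ → ℝ} (hφ : ContDiff ℝ 1 φ) (hφs : HasCompactSupport φ)
    {w : ℝ × ℝ} (hw : w ≠ 0) (y x : ℝ × ℝ) : Dw y (Xray w φ) x = Xray w (Dw y φ) x := by
  rw [Dw, (hasFDerivAt_Xray hφ hφs hw x).fderiv]
  exact ContinuousLinearMap.integral_apply
    (integrable_comp_ray (hφ.continuous_fderiv one_ne_zero) (hφs.fderiv ℝ) hw x).integrableOn y

lemma differentiable_Xray {φ : ℝ × ℝ → ℝ} (hφ : ContDiff ℝ 1 φ) (hφs : HasCompactSupport φ)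
    {w : ℝ × ℝ} (hw : w ≠ 0) : Differentiable ℝ (Xray w φ) :=
  fun x => (hasFDerivAt_Xray hφ hφs hw x).differentiableAt

lemma ContDiff.Dw {φ : ℝ × ℝ → ℝ} {m n : ℕ} (hφ : ContDiff ℝ n φ) (hmn : m + 1 ≤ n)
    (w : ℝ × ℝ) : ContDiff ℝ m (Dw w φ) :=
  (hφ.fderiv_right (by exact_mod_cast hmn)).clm_apply contDiff_const

lemma HasCompactSupport.Dw {φ : ℝ × ℝ → ℝ} (hφ : HasCompactSupport φ) (w : ℝ × ℝ) :
    HasCompactSupport (Dw w φ) :=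
  hφ.fderiv_apply ℝ w

lemma Dw_eq_pdx_pdy (w : ℝ × ℝ) (φ : ℝ × ℝ → ℝ) (x : ℝ × ℝ) :
    Dw w φ x = w.1 * pdx φ x + w.2 * pdy φ x := by
  have hw : w = w.1 • ((1, 0) : ℝ × ℝ) + w.2 • ((0, 1) : ℝ × ℝ) := by ext <;> simp
  conv_lhs => rw [hw]
  simp only [Dw, pdx, pdy, map_add, map_smul, smul_eq_mul]

lemma Dw_add {φ ψ : ℝ × ℝ → ℝ} (hφ : Differentiable ℝ φ) (hψ : Differentiable ℝ ψ)
    (w x : ℝ × ℝ) : Dw w (fun y => φ y + ψ y) x = Dw w φ x + Dw w ψ x := by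
  simp [Dw, fderiv_fun_add (hφ x) (hψ x)]

lemma Dw_const_mul {φ : ℝ × ℝ → ℝ} (hφ : Differentiable ℝ φ) (c : ℝ) (w x : ℝ × ℝ) :
    Dw w (fun y => c * φ y) x = c * Dw w φ x := by
  simp [Dw, fderiv_const_mul (hφ x)]

lemma Dw_comm {φ : ℝ × ℝ → ℝ} (hφ : ContDiff ℝ 2 φ) (w y x : ℝ × ℝ) :
    Dw w (Dw y φ) x = Dw y (Dw w φ) x := by
  have hd : DifferentiableAt ℝ (fderiv ℝ φ) x :=
    (hφ.fderiv_right (m := 1) (by norm_num)).differentiable one_ne_zero x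
  have key : ∀ a b : ℝ × ℝ, Dw a (Dw b φ) x = fderiv ℝ (fderiv ℝ φ) x a b := by
    intro a b
    change fderiv ℝ (fun z => fderiv ℝ φ z b) x a = _
    simp [fderiv_clm_apply hd (differentiableAt_const b)]
  rw [key, key]
  exact (hφ.contDiffAt.isSymmSndFDerivAt (by simp)) w y

lemma isBounded_unitDisk : Bornology.IsBounded unitDisk := by
  refine (Metric.isBounded_closedBall (x := (0 : ℝ × ℝ)) (r := 1)).subset fun x hx => ?_
  have hx' : x.1 ^ 2 + x.2 ^ 2 < 1 := hx
  rw [mem_closedBall_zero_iff, Prod.norm_def]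
  refine max_le ?_ ?_ <;> rw [Real.norm_eq_abs, abs_le] <;> constructor <;>
    nlinarith [sq_nonneg x.1, sq_nonneg x.2]

lemma hasCompactSupport_of_tsupport_subset_unitDisk_s5 {φ : ℝ × ℝ → ℝ}
    (hφ : tsupport φ ⊆ unitDisk) : HasCompactSupport φ :=
  Metric.isCompact_of_isClosed_isBounded (isClosed_tsupport φ) (isBounded_unitDisk.subset hφ)

/-- For `f = dg`, the mixed beam transform plus the beam transform of `∂g2/∂x1` only involves
boundary values of `g` and the beam transform of `∂g1/∂x2`. -/
lemma two_mul_Xray_projMix_add {g1 g2 : ℝ × ℝ → ℝ} (hg1 : ContDiff ℝ 1 g1)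
    (hg2 : ContDiff ℝ 1 g2) (hs1 : HasCompactSupport g1) (hs2 : HasCompactSupport g2)
    {w : ℝ × ℝ} (hw : w ≠ 0) (hw1 : w.1 ^ 2 + w.2 ^ 2 = 1) (x : ℝ × ℝ) :
    2 * Xray w (projMix (pdx g1) (fun y => (1 / 2) * (pdy g1 y + pdx g2 y)) (pdy g2) w) x
        + Xray w (pdx g2) x =
      2 * w.2 * g1 x - 2 * w.1 * g2 x + Xray w (pdy g1) x := by
  have c1 : ∀ y, Continuous (Dw y g1) := fun y => (ContDiff.Dw (m := 0) hg1 le_rfl y).continuous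
  have c2 : ∀ y, Continuous (Dw y g2) := fun y => (ContDiff.Dw (m := 0) hg2 le_rfl y).continuous
  have hP : 2 * Xray w (projMix (pdx g1) (fun y => (1 / 2) * (pdy g1 y + pdx g2 y)) (pdy g2) w) x
      = Xray w (fun y => (-(2 * w.2) * Dw w g1 y + 2 * w.1 * Dw w g2 y)
          + (pdy g1 y + -1 * pdx g2 y)) x := by
    rw [← Xray_const_mul]
    congr 1
    funext y
    simp only [projMix, Dw_eq_pdx_pdy w]
    linear_combination (pdy g1 y - pdx g2 y) * hw1
  have e1 := Xray_Dw_self hg1 hs1 hw x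
  have e2 := Xray_Dw_self hg2 hs2 hw x
  have s1 : HasCompactSupport fun y => -(2 * w.2) * Dw w g1 y := (hs1.Dw w).mul_left
  have s2 : HasCompactSupport fun y => 2 * w.1 * Dw w g2 y := (hs2.Dw w).mul_left
  have s3 : HasCompactSupport (pdy g1) := hs1.Dw _
  have s4 : HasCompactSupport fun y => -1 * pdx g2 y := (hs2.Dw (1, 0)).mul_left
  have k1 : Continuous fun y => -(2 * w.2) * Dw w g1 y := (c1 w).const_mul _
  have k2 : Continuous fun y => 2 * w.1 * Dw w g2 y := (c2 w).const_mul _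
  have k3 : Continuous (pdy g1) := c1 _
  have k4 : Continuous fun y => -1 * pdx g2 y := (c2 (1, 0)).const_mul _
  have s12 : HasCompactSupport fun y => -(2 * w.2) * Dw w g1 y + 2 * w.1 * Dw w g2 y := s1.add s2
  have s34 : HasCompactSupport fun y => pdy g1 y + -1 * pdx g2 y := s3.add s4
  rw [hP, Xray_add (by fun_prop) s12 (by fun_prop) s34 hw,
    Xray_add k1 s1 k2 s2 hw, Xray_add k3 s3 k4 s4 hw,
    Xray_const_mul, Xray_const_mul, Xray_const_mul, e1, e2]
  ring

theorem stmt_5 (u1 u2 : ℝ) (hu1 : 0 < u1) (hu2 : 0 < u2) (huv : u1 ^ 2 + u2 ^ 2 = 1)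
    (g1 g2 : ℝ × ℝ → ℝ) (hg1 : ContDiff ℝ 3 g1) (hg2 : ContDiff ℝ 3 g2)
    (hg1supp : tsupport g1 ⊆ unitDisk) (hg2supp : tsupport g2 ⊆ unitDisk)
    (f11 f12 f22 : ℝ × ℝ → ℝ)
    (hf11 : f11 = pdx g1)
    (hf12 : f12 = fun x => (1 / 2) * (pdy g1 x + pdx g2 x))
    (hf22 : f22 = pdy g2)
    (h : ℝ × ℝ → ℝ)
    (hh : h = fun x => 2 * Mf (u1, u2) (-u1, u2) f11 f12 f22 x + Vlt (u1, u2) (-u1, u2) (pdx g2) x) :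
    ∀ x : ℝ × ℝ,
      2 * u1 ^ 2 * pdx (pdx g1) x + (u1 ^ 2 - u2 ^ 2) * pdy (pdy g1) x =
        -(1 / (2 * u2)) * Dw (u1, u2) (Dw (-u1, u2) h) x := by
  intro x
  have hs1 := hasCompactSupport_of_tsupport_subset_unitDisk_s5 hg1supp
  have hs2 := hasCompactSupport_of_tsupport_subset_unitDisk_s5 hg2supp
  have hu : ((u1, u2) : ℝ × ℝ) ≠ 0 := by simp [hu1.ne']
  have hv : ((-u1, u2) : ℝ × ℝ) ≠ 0 := by simp [hu1.ne']
  have hg1' : ContDiff ℝ 1 g1 := hg1.of_le (by norm_num)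
  have hg2' : ContDiff ℝ 1 g2 := hg2.of_le (by norm_num)
  have hφ2 : ContDiff ℝ 2 (pdy g1) := ContDiff.Dw (m := 2) (n := 3) hg1 le_rfl _
  have hφ : ContDiff ℝ 1 (pdy g1) := hφ2.of_le (by norm_num)
  have hφs : HasCompactSupport (pdy g1) := hs1.Dw _
  have hψ : ContDiff ℝ 1 (Dw (-u1, u2) (pdy g1)) := ContDiff.Dw (m := 1) (n := 2) hφ2 le_rfl _
  have hψs : HasCompactSupport (Dw (-u1, u2) (pdy g1)) := hφs.Dw _
  have hDg : ∀ w, ContDiff ℝ 2 (Dw w g1) := fun w => ContDiff.Dw (m := 2) (n := 3) hg1 le_rfl w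
  have dDg : ∀ w, Differentiable ℝ (Dw w g1) := fun w => (hDg w).differentiable two_ne_zero
  have hh' : h = fun y => 4 * u2 * g1 y
      + (Xray (u1, u2) (pdy g1) y + Xray (-u1, u2) (pdy g1) y) := by
    rw [hh]
    funext y
    have eu := two_mul_Xray_projMix_add hg1' hg2' hs1 hs2 hu huv y
    have ev := two_mul_Xray_projMix_add hg1' hg2' hs1 hs2 hv (by simpa using huv) y
    simp only [Mf, Vlt, hf11, hf12, hf22]
    dsimp only at eu ev
    linear_combination eu + ev
  have dg := hg1'.differentiable one_ne_zero
  have dφ := hφ.differentiable one_ne_zero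
  have hDv : Dw (-u1, u2) h = fun y => 4 * u2 * Dw (-u1, u2) g1 y
      + (Xray (u1, u2) (Dw (-u1, u2) (pdy g1)) y + -1 * pdy g1 y) := by
    funext y
    rw [hh', Dw_add (dg.const_mul _) ((differentiable_Xray hφ hφs hu).fun_add
        (differentiable_Xray hφ hφs hv)), Dw_const_mul dg,
      Dw_add (differentiable_Xray hφ hφs hu) (differentiable_Xray hφ hφs hv),
      Dw_Xray hφ hφs hu, Dw_Xray hφ hφs hv, Xray_Dw_self hφ hφs hv]
    ring
  have hDuv : Dw (u1, u2) (Dw (-u1, u2) h) x =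
      4 * u2 * Dw (u1, u2) (Dw (-u1, u2) g1) x - Dw (-u1, u2) (pdy g1) x
        - Dw (u1, u2) (pdy g1) x := by
    rw [hDv, Dw_add ((dDg _).const_mul _) ((differentiable_Xray hψ hψs hu).fun_add
        (dφ.const_mul _)), Dw_const_mul (dDg _),
      Dw_add (differentiable_Xray hψ hψs hu) (dφ.const_mul _), Dw_const_mul dφ,
      Dw_Xray hψ hψs hu, Xray_Dw_self hψ hψs hu]
    ring
  have hDD : Dw (u1, u2) (Dw (-u1, u2) g1) x =
      -u1 ^ 2 * pdx (pdx g1) x + u2 ^ 2 * pdy (pdy g1) x := by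
    have e : Dw (-u1, u2) g1 = fun y => -u1 * pdx g1 y + u2 * pdy g1 y :=
      funext fun y => Dw_eq_pdx_pdy _ _ y
    have dx : Differentiable ℝ (pdx g1) := dDg _
    have hcomm : pdx (pdy g1) x = pdy (pdx g1) x := Dw_comm (hg1.of_le (by norm_num)) _ _ x
    rw [e, Dw_add (dx.const_mul _) (dφ.const_mul _), Dw_const_mul dx, Dw_const_mul dφ,
      Dw_eq_pdx_pdy, Dw_eq_pdx_pdy, hcomm]
    ring
  rw [hDuv, hDD, Dw_eq_pdx_pdy, Dw_eq_pdx_pdy]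
  field_simp
  linear_combination 2 * u2 * (pdy (pdy g1) x) * huv
end
end

section
/- Let f = (f11,f12,f22) be a symmetric 2-tensor field with C² components compactly supported in the open unit disk, and assume u1 = u2 (i.e. u1 = u2 = 1/√2). Then for every x ∈ ℝ², f12(x) = (1/(4·u1))·D_u D_v X_{-e1}(Lf - Tf)(x), where X_{-e1} denotes the divergent beam transform in the direction -e1. -/
open MeasureTheory

noncomputable section

open Set Filter Topology

/-- `h` vanishes far out in the direction `w`, locally uniformly in the base point. -/
def VanishesAlong (w : ℝ × ℝ) (h : ℝ × ℝ → ℝ) : Prop :=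
  ∀ B : ℝ, ∃ R : ℝ, 0 ≤ R ∧ ∀ x : ℝ × ℝ, ‖x‖ ≤ B → ∀ t, R ≤ t → h (x + t • w) = 0

theorem VanishesAlong.add {w : ℝ × ℝ} {g h : ℝ × ℝ → ℝ} (hg : VanishesAlong w g)
    (hh : VanishesAlong w h) : VanishesAlong w (fun y => g y + h y) := by
  intro B
  obtain ⟨R, hR, H⟩ := hg B
  obtain ⟨S, hS, K⟩ := hh B
  refine ⟨max R S, le_max_of_le_left hR, fun x hx t ht => ?_⟩
  simp [H x hx t ((le_max_left _ _).trans ht), K x hx t ((le_max_right _ _).trans ht)]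

theorem VanishesAlong.neg {w : ℝ × ℝ} {h : ℝ × ℝ → ℝ} (hh : VanishesAlong w h) :
    VanishesAlong w (fun y => -h y) := by
  intro B
  obtain ⟨R, hR, H⟩ := hh B
  exact ⟨R, hR, fun x hx t ht => by simp [H x hx t ht]⟩

theorem VanishesAlong.sub {w : ℝ × ℝ} {g h : ℝ × ℝ → ℝ} (hg : VanishesAlong w g)
    (hh : VanishesAlong w h) : VanishesAlong w (fun y => g y - h y) := by
  simpa only [sub_eq_add_neg] using hg.add hh.neg

theorem VanishesAlong.dw {w : ℝ × ℝ} {h : ℝ × ℝ → ℝ} (hh : VanishesAlong w h) (z : ℝ × ℝ) :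
    VanishesAlong w (Dw z h) := by
  intro B
  obtain ⟨R, hR, H⟩ := hh (B + 1)
  refine ⟨R, hR, fun x hx t ht => ?_⟩
  have : h =ᶠ[𝓝 (x + t • w)] fun _ => 0 := by
    filter_upwards [Metric.ball_mem_nhds (x + t • w) one_pos] with y hy
    have hy' : ‖y - t • w‖ ≤ B + 1 := by
      have e : y - t • w = x + (y - (x + t • w)) := by abel
      rw [mem_ball_iff_norm] at hy
      rw [e]
      exact (norm_add_le _ _).trans (add_le_add hx hy.le)
    simpa using H _ hy' t ht
  simp [Dw, this.fderiv_eq]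

theorem Xray_eq_intervalIntegral {w : ℝ × ℝ} {h : ℝ × ℝ → ℝ} {x : ℝ × ℝ} {R : ℝ} (hR : 0 ≤ R)
    (H : ∀ t, R ≤ t → h (x + t • w) = 0) : Xray w h x = ∫ t in (0:ℝ)..R, h (x + t • w) := by
  rw [Xray, intervalIntegral.integral_of_le hR]
  refine setIntegral_eq_of_subset_of_forall_sdiff_eq_zero measurableSet_Ioi
    (fun t ht => ht.1) fun t ht => H t ?_
  by_contra hlt
  exact ht.2 ⟨ht.1, (not_le.1 hlt).le⟩

theorem VanishesAlong.eventuallyEq {w : ℝ × ℝ} {h : ℝ × ℝ → ℝ} (hh : VanishesAlong w h)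
    (x : ℝ × ℝ) : ∃ R : ℝ, 0 ≤ R ∧ (∀ t, R ≤ t → h (x + t • w) = 0) ∧
      (∀ z t, R ≤ t → Dw z h (x + t • w) = 0) ∧
      Xray w h =ᶠ[𝓝 x] fun y => ∫ t in (0:ℝ)..R, h (y + t • w) := by
  obtain ⟨R, hR, H⟩ := hh (‖x‖ + 1)
  have near : ∀ᶠ y in 𝓝 x, ‖y‖ ≤ ‖x‖ + 1 :=
    (continuous_norm.tendsto x).eventually_le_const (lt_add_one _)
  have ev : ∀ t, R ≤ t → h =ᶠ[𝓝 (x + t • w)] fun _ => 0 := by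
    intro t ht
    have : Tendsto (fun y : ℝ × ℝ => y - t • w) (𝓝 (x + t • w)) (𝓝 x) := by
      have : Continuous fun y : ℝ × ℝ => y - t • w := by fun_prop
      simpa using this.tendsto (x + t • w)
    filter_upwards [this.eventually near] with y hy
    simpa using H _ hy t ht
  refine ⟨R, hR, fun t ht => (ev t ht).self_of_nhds, fun z t ht => ?_, ?_⟩
  · simp [Dw, (ev t ht).fderiv_eq]
  · filter_upwards [near] with y hy
    exact Xray_eq_intervalIntegral hR (H y hy)

theorem continuous_Xray {w : ℝ × ℝ} {h : ℝ × ℝ → ℝ} (hc : Continuous h)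
    (hh : VanishesAlong w h) : Continuous (Xray w h) := by
  refine continuous_iff_continuousAt.2 fun x => ?_
  obtain ⟨R, -, -, -, he⟩ := hh.eventuallyEq x
  refine ContinuousAt.congr (Continuous.continuousAt ?_) he.symm
  exact intervalIntegral.continuous_parametric_intervalIntegral_of_continuous' (by fun_prop) 0 R

theorem hasFDerivAt_intervalIntegral_ray {h : ℝ × ℝ → ℝ} (hc : ContDiff ℝ 1 h)
    (w : ℝ × ℝ) (R : ℝ) (x : ℝ × ℝ) :
    HasFDerivAt (fun y => ∫ t in (0:ℝ)..R, h (y + t • w))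
      (∫ t in (0:ℝ)..R, fderiv ℝ h (x + t • w)) x := by
  have hd : Continuous (fderiv ℝ h) := hc.continuous_fderiv one_ne_zero
  have h0 : Continuous h := hc.continuous
  obtain ⟨C, hC⟩ := ((isCompact_closedBall x 1).prod (isCompact_uIcc (a := 0) (b := R))
    ).exists_bound_of_continuousOn
      (f := fun p : (ℝ × ℝ) × ℝ => fderiv ℝ h (p.1 + p.2 • w)) (by fun_prop)
  refine intervalIntegral.hasFDerivAt_integral_of_dominated_of_fderiv_le
    (bound := fun _ => C) (F' := fun y t => fderiv ℝ h (y + t • w))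
    (Metric.closedBall_mem_nhds x one_pos) ?_ ?_ ?_ ?_ ?_ ?_
  · exact .of_forall fun y => Continuous.aestronglyMeasurable (by fun_prop)
  · exact Continuous.intervalIntegrable (by fun_prop) _ _
  · exact Continuous.aestronglyMeasurable (by fun_prop)
  · exact .of_forall fun t ht y hy => hC (y, t) ⟨hy, uIoc_subset_uIcc ht⟩
  · exact intervalIntegrable_const
  · refine .of_forall fun t _ y _ => ?_
    exact (hasFDerivAt_comp_add_right (t • w)).2
      (hc.differentiable one_ne_zero (y + t • w)).hasFDerivAt

/-- The divergent beam transform commutes with differentiation. -/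
theorem Dw_Xray_s9 {w : ℝ × ℝ} {h : ℝ × ℝ → ℝ} (hc : ContDiff ℝ 1 h)
    (hh : VanishesAlong w h) (z : ℝ × ℝ) : Dw z (Xray w h) = Xray w (Dw z h) := by
  funext x
  obtain ⟨R, hR, -, hz, he⟩ := hh.eventuallyEq x
  have hd : Continuous (fderiv ℝ h) := hc.continuous_fderiv one_ne_zero
  rw [Dw, he.fderiv_eq, (hasFDerivAt_intervalIntegral_ray hc w R x).fderiv,
    Xray_eq_intervalIntegral hR (hz z), ContinuousLinearMap.intervalIntegral_apply]
  · rfl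
  · exact Continuous.intervalIntegrable (by fun_prop) _ _

theorem contDiff_Dw {h : ℝ × ℝ → ℝ} {m n : WithTop ℕ∞} (hc : ContDiff ℝ n h) (hmn : m + 1 ≤ n)
    (z : ℝ × ℝ) : ContDiff ℝ m (Dw z h) :=
  (hc.fderiv_right hmn).clm_apply contDiff_const

theorem contDiff_Xray {w : ℝ × ℝ} {h : ℝ × ℝ → ℝ} (hc : ContDiff ℝ 1 h)
    (hh : VanishesAlong w h) : ContDiff ℝ 1 (Xray w h) := by
  refine contDiff_one_iff_fderiv.2 ⟨fun x => ?_, continuous_clm_apply.2 fun z => ?_⟩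
  · obtain ⟨R, -, -, -, he⟩ := hh.eventuallyEq x
    exact ((hasFDerivAt_intervalIntegral_ray hc w R x).congr_of_eventuallyEq he).differentiableAt
  · change Continuous (Dw z (Xray w h))
    rw [Dw_Xray_s9 hc hh]
    exact continuous_Xray (contDiff_Dw (m := 0) hc (by simp) z).continuous (hh.dw z)

theorem Xray_Dw_self_s9 {w : ℝ × ℝ} {h : ℝ × ℝ → ℝ} (hc : ContDiff ℝ 1 h)
    (hh : VanishesAlong w h) (x : ℝ × ℝ) : Xray w (Dw w h) x = -h x := by
  obtain ⟨R, hR, h0, hz, -⟩ := hh.eventuallyEq x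
  have hd : Continuous (fderiv ℝ h) := hc.continuous_fderiv one_ne_zero
  rw [Xray_eq_intervalIntegral hR (hz w),
    intervalIntegral.integral_eq_sub_of_hasDerivAt (f := fun t : ℝ => h (x + t • w))]
  · simp [h0 R le_rfl]
  · intro t _
    have hline : HasDerivAt (fun t : ℝ => x + t • w) w t := by
      simpa using ((hasDerivAt_id t).smul_const w).const_add x
    exact (hc.differentiable one_ne_zero _).hasFDerivAt.comp_hasDerivAt t hline
  · exact Continuous.intervalIntegrable (by unfold Dw; fun_prop) _ _

theorem integrableOn_ray {w : ℝ × ℝ} {h : ℝ × ℝ → ℝ} (hc : Continuous h)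
    (hh : VanishesAlong w h) (x : ℝ × ℝ) : IntegrableOn (fun t : ℝ => h (x + t • w)) (Ioi 0) := by
  obtain ⟨R, -, h0, -, -⟩ := hh.eventuallyEq x
  have hI : IntegrableOn (fun t : ℝ => h (x + t • w)) (Icc 0 R) :=
    Continuous.integrableOn_Icc (by fun_prop)
  refine hI.of_forall_sdiff_eq_zero measurableSet_Ioi fun t ht => h0 t ?_
  by_contra hlt
  exact ht.2 ⟨le_of_lt ht.1, (not_le.1 hlt).le⟩

theorem Xray_sub {w : ℝ × ℝ} {g h : ℝ × ℝ → ℝ} (hg : Continuous g) (hgw : VanishesAlong w g)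
    (hh : Continuous h) (hhw : VanishesAlong w h) (x : ℝ × ℝ) :
    Xray w (fun y => g y - h y) x = Xray w g x - Xray w h x :=
  integral_sub (integrableOn_ray hg hgw x) (integrableOn_ray hh hhw x)

theorem vanishesAlong_of_tsupport {h : ℝ × ℝ → ℝ} (hs : tsupport h ⊆ Metric.ball 0 1)
    {w : ℝ × ℝ} (hw : w ≠ 0) : VanishesAlong w h := by
  intro B
  have hw' : 0 < ‖w‖ := norm_pos_iff.2 hw
  refine ⟨(1 + |B|) / ‖w‖, by positivity, fun x hx t ht => ?_⟩
  refine image_eq_zero_of_notMem_tsupport fun hm => ?_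
  have h1 := mem_ball_zero_iff.1 (hs hm)
  have h2 : ‖t • w‖ ≤ ‖x + t • w‖ + ‖x‖ := by
    simpa using norm_sub_le (x + t • w) x
  rw [norm_smul, Real.norm_eq_abs] at h2
  rw [div_le_iff₀ hw'] at ht
  have h3 := mul_le_mul_of_nonneg_right (le_abs_self t) hw'.le
  linarith [le_abs_self B]

theorem vanishesAlong_Xray {h : ℝ × ℝ → ℝ} (hs : tsupport h ⊆ Metric.ball 0 1)
    {w : ℝ × ℝ} (hw : 0 < w.2) : VanishesAlong (-1, 0) (Xray w h) := by
  intro B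
  refine ⟨(1 + |B|) + (1 + |B|) / w.2 * |w.1|, by positivity, fun x hx t ht => ?_⟩
  refine setIntegral_eq_zero_of_forall_eq_zero fun s hs0 => ?_
  refine image_eq_zero_of_notMem_tsupport fun hm => ?_
  have h1 := mem_ball_zero_iff.1 (hs hm)
  simp only [Prod.norm_def, sup_lt_iff, Prod.fst_add, Prod.snd_add, Prod.smul_fst, Prod.smul_snd,
    smul_eq_mul, Real.norm_eq_abs, sup_le_iff, abs_lt, abs_le] at h1 hx
  have hB := le_abs_self B
  have h2 : s ≤ (1 + |B|) / w.2 := by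
    rw [le_div_iff₀ hw]
    linarith [h1.2.2, hx.2.1]
  have h3 : s * w.1 ≤ (1 + |B|) / w.2 * |w.1| :=
    (mul_le_mul_of_nonneg_left (le_abs_self _) (le_of_lt hs0)).trans
      (mul_le_mul_of_nonneg_right h2 (abs_nonneg _))
  linarith [h1.1.1, hx.1.2]

theorem Dw_sub {g h : ℝ × ℝ → ℝ} (hg : Differentiable ℝ g) (hh : Differentiable ℝ h)
    (z : ℝ × ℝ) : Dw z (fun y => g y - h y) = fun y => Dw z g y - Dw z h y := by
  funext x
  simp only [Dw]
  rw [fderiv_fun_sub (hg x) (hh x)]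
  rfl

/-- Inversion of the signed V-line transform `X_u - X_v` on compactly supported functions. -/
theorem Dw_Dw_Xray_signed_vline {u1 u2 : ℝ} (hu2 : 0 < u2) {k : ℝ × ℝ → ℝ}
    (hk : ContDiff ℝ 2 k) (hs : tsupport k ⊆ Metric.ball 0 1) (x : ℝ × ℝ) :
    Dw (u1, u2) (Dw (-u1, u2) (Xray (-1, 0)
      (fun y => Xray (u1, u2) k y - Xray (-u1, u2) k y))) x = 2 * u1 * k x := by
  set u : ℝ × ℝ := (u1, u2) with hu
  set v : ℝ × ℝ := (-u1, u2) with hv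
  have hu0 : u ≠ 0 := fun h => hu2.ne' (congrArg Prod.snd h)
  have hv0 : v ≠ 0 := fun h => hu2.ne' (congrArg Prod.snd h)
  have he0 : ((-1, 0) : ℝ × ℝ) ≠ 0 := by simp
  have hk1 : ContDiff ℝ 1 k := hk.of_le one_le_two
  have hdk : ∀ z, ContDiff ℝ 1 (Dw z k) := fun z => contDiff_Dw hk (by norm_num) z
  have hsd : ∀ z, tsupport (Dw z k) ⊆ Metric.ball 0 1 := fun z =>
    (tsupport_fderiv_apply_subset ℝ z).trans hs
  have hXu := contDiff_Xray hk1 (vanishesAlong_of_tsupport hs hu0)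
  have hXv := contDiff_Xray hk1 (vanishesAlong_of_tsupport hs hv0)
  have hXd := contDiff_Xray (hdk v) (vanishesAlong_of_tsupport (hsd v) hu0)
  have deriv_v : Dw v (fun y => Xray u k y - Xray v k y)
      = fun y => Xray u (Dw v k) y - (-k y) := by
    rw [Dw_sub (hXu.differentiable one_ne_zero) (hXv.differentiable one_ne_zero),
      Dw_Xray_s9 hk1 (vanishesAlong_of_tsupport hs hu0),
      Dw_Xray_s9 hk1 (vanishesAlong_of_tsupport hs hv0)]
    funext y
    rw [Xray_Dw_self_s9 hk1 (vanishesAlong_of_tsupport hs hv0)]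
  have deriv_u : Dw u (fun y => Xray u (Dw v k) y - (-k y)) = Dw (2 * u1, 0) k := by
    rw [Dw_sub (hXd.differentiable one_ne_zero) (hk1.neg.differentiable one_ne_zero),
      Dw_Xray_s9 (hdk v) (vanishesAlong_of_tsupport (hsd v) hu0)]
    funext y
    rw [Xray_Dw_self_s9 (hdk v) (vanishesAlong_of_tsupport (hsd v) hu0)]
    have : ((2 * u1, 0) : ℝ × ℝ) = u - v := by
      simp [hu, hv]; ring
    rw [this]
    simp only [Dw, fderiv_fun_neg, map_sub]
    simp
    ring
  rw [Dw_Xray_s9 (hXu.sub hXv) ((vanishesAlong_Xray hs hu2).sub (vanishesAlong_Xray hs hu2)), deriv_v,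
    Dw_Xray_s9 (hXd.sub hk1.neg)
      ((vanishesAlong_Xray (hsd v) hu2).sub (vanishesAlong_of_tsupport hs he0).neg), deriv_u]
  have scale : Dw (2 * u1, 0) k = fun y => (-(2 * u1)) * Dw (-1, 0) k y := by
    funext y
    have : ((2 * u1, 0) : ℝ × ℝ) = (-(2 * u1)) • ((-1, 0) : ℝ × ℝ) := by simp
    rw [this]
    simp only [Dw, map_smul, smul_eq_mul]
  have pull : Xray (-1, 0) (fun y => (-(2 * u1)) * Dw (-1, 0) k y) x
      = (-(2 * u1)) * Xray (-1, 0) (Dw (-1, 0) k) x := integral_const_mul _ _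
  rw [scale, pull, Xray_Dw_self_s9 hk1 (vanishesAlong_of_tsupport hs he0)]
  ring

theorem unitDisk_subset_ball : unitDisk ⊆ Metric.ball 0 1 := by
  intro x hx
  have hx' : x.1 ^ 2 + x.2 ^ 2 < 1 := hx
  simp only [mem_ball_zero_iff, Prod.norm_def, sup_lt_iff, Real.norm_eq_abs,
    ← sq_lt_one_iff_abs_lt_one]
  constructor <;> nlinarith [sq_nonneg x.1, sq_nonneg x.2]

theorem vanishesAlong_proj2 {f11 f12 f22 : ℝ × ℝ → ℝ} {w : ℝ × ℝ} (h11 : VanishesAlong w f11)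
    (h12 : VanishesAlong w f12) (h22 : VanishesAlong w f22) (z : ℝ × ℝ) :
    VanishesAlong w (proj2 f11 f12 f22 z) := by
  intro B
  obtain ⟨R, hR, H⟩ := h11 B
  obtain ⟨S, hS, K⟩ := h12 B
  obtain ⟨T, hT, L⟩ := h22 B
  refine ⟨max R (max S T), le_max_of_le_left hR, fun x hx t ht => ?_⟩
  simp only [sup_le_iff] at ht
  simp [proj2, H x hx t ht.1, K x hx t ht.2.1, L x hx t ht.2.2]

theorem stmt_9 (u1 u2 : ℝ) (hu1 : 0 < u1) (hu2 : 0 < u2) (huv : u1 ^ 2 + u2 ^ 2 = 1)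
    (f11 f12 f22 : ℝ × ℝ → ℝ)
    (hf11 : ContDiff ℝ 2 f11) (hf12 : ContDiff ℝ 2 f12) (hf22 : ContDiff ℝ 2 f22)
    (hs11 : tsupport f11 ⊆ unitDisk) (hs12 : tsupport f12 ⊆ unitDisk)
    (hs22 : tsupport f22 ⊆ unitDisk)
    (hueq : u1 = u2) :
    ∀ x : ℝ × ℝ,
      f12 x =
        (1 / (4 * u1)) *
          Dw (u1, u2) (Dw (-u1, u2) (Xray (-1, 0) (fun y => Lf (u1, u2) (-u1, u2) f11 f12 f22 y - Tf (u1, u2) (-u1, u2) f11 f12 f22 y))) x := by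
  intro x
  subst hueq
  have hc : u1 ^ 2 = 1 / 2 := by linarith
  have b11 := hs11.trans unitDisk_subset_ball
  have b12 := hs12.trans unitDisk_subset_ball
  have b22 := hs22.trans unitDisk_subset_ball
  have hu0 : ((u1, u1) : ℝ × ℝ) ≠ 0 := fun h => hu1.ne' (congrArg Prod.snd h)
  have hv0 : ((-u1, u1) : ℝ × ℝ) ≠ 0 := fun h => hu1.ne' (congrArg Prod.snd h)
  have cont : ∀ z, Continuous (proj2 f11 f12 f22 z) := fun z => by
    have := hf11.continuous
    have := hf12.continuous
    have := hf22.continuous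
    unfold proj2
    fun_prop
  have van : ∀ w : ℝ × ℝ, w ≠ 0 → ∀ z, VanishesAlong w (proj2 f11 f12 f22 z) := fun w hw =>
    vanishesAlong_proj2 (vanishesAlong_of_tsupport b11 hw) (vanishesAlong_of_tsupport b12 hw)
      (vanishesAlong_of_tsupport b22 hw)
  have key : (fun y => Lf (u1, u1) (-u1, u1) f11 f12 f22 y - Tf (u1, u1) (-u1, u1) f11 f12 f22 y)
      = fun y => Xray (u1, u1) (fun y => 2 * f12 y) y - Xray (-u1, u1) (fun y => 2 * f12 y) y := by
    funext y
    have eu : (fun y => 2 * f12 y) = fun y => proj2 f11 f12 f22 (u1, u1) y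
        - proj2 f11 f12 f22 (perp (u1, u1)) y := by
      funext y
      simp only [proj2, perp]
      linear_combination (-4 * f12 y) * hc
    have ev : (fun y => 2 * f12 y) = fun y => proj2 f11 f12 f22 (perp (-u1, u1)) y
        - proj2 f11 f12 f22 (-u1, u1) y := by
      funext y
      simp only [proj2, perp]
      linear_combination (-4 * f12 y) * hc
    nth_rw 1 [eu]
    rw [ev, Xray_sub (cont _) (van _ hu0 _) (cont _) (van _ hu0 _),
      Xray_sub (cont _) (van _ hv0 _) (cont _) (van _ hv0 _), Lf, Tf]
    ring
  have hs : tsupport (fun y => 2 * f12 y) ⊆ Metric.ball 0 1 :=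
    (tsupport_mul_subset_right (f := fun _ => (2:ℝ))).trans b12
  rw [key, Dw_Dw_Xray_signed_vline hu1 (contDiff_const.mul hf12) hs]
  field_simp
  norm_num
end
end
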